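/- Let X : [0,T] → ℝ^d be Lipschitz, let V_1,…,V_d : ℝ^N → ℝ^N be smooth with globally bounded derivatives, and for η ∈ ℝ^N and r ∈ ℝ let Y^{η,r} be the unique solution of Y_t = η + Σ_{i=1}^d ∫_0^t r V_i(Y_s) dX_s^i. Then for every g ∈ C^∞(ℝ^N), every t ∈ [0,T] and every m ∈ ℕ, the map r ↦ g(Y_t^{η,r}) is smooth and (1/m!) (d^m/dr^m) g(Y_t^{η,r}) |_{r=0} = Σ_{w ∈ 𝒲_m} V_w g(η) ∫_{Δ^m_{[0,t]}} dX^w. -/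

import Mathlib

open MeasureTheory

/-- The first-order differential operator associated with a vector field `V i`:
`(V_i φ)(x) = (∇φ(x))ᵀ V_i(x)`. -/
noncomputable def vfOp {N d : ℕ} (V : Fin d → (Fin N → ℝ) → (Fin N → ℝ)) (i : Fin d)
    (φ : (Fin N → ℝ) → ℝ) : (Fin N → ℝ) → ℝ :=
  fun x => fderiv ℝ φ x (V i x)

/-- The iterated operator `V_w = 𝒟_{V_{w₁}} ∘ ⋯ ∘ 𝒟_{V_{w_m}}` associated with a word
`w = (w₁, …, w_m)` (represented as the list `[w₁, …, w_m]`). -/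
noncomputable def iterOp {N d : ℕ} (V : Fin d → (Fin N → ℝ) → (Fin N → ℝ)) :
    List (Fin d) → ((Fin N → ℝ) → ℝ) → (Fin N → ℝ) → ℝ
  | [], φ => φ
  | i :: w, φ => vfOp V i (iterOp V w φ)

/-- Nested iterated integral against `dX` (via the a.e. derivative `X'` of the Lipschitz path),
with innermost integrand `f`; the list is processed outermost-first. -/
noncomputable def remInt {d : ℕ} (X' : ℝ → Fin d → ℝ) (f : ℝ → ℝ) :
    List (Fin d) → ℝ → ℝ
  | [], t => f t
  | i :: w, t => ∫ r in (0:ℝ)..t, X' r i * remInt X' f w r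

/-- The iterated integral `∫_{Δ^m_{[0,t]}} dX^w` for the word `w = [w₁, …, w_m]`,
with `r₁` the innermost integration variable (paired with the letter `w₁`). -/
noncomputable def iterInt {d : ℕ} (X' : ℝ → Fin d → ℝ) (w : List (Fin d)) (t : ℝ) : ℝ :=
  remInt X' (fun _ => 1) w.reverse t

section Superposition

variable {K E F : Type} [TopologicalSpace K] [CompactSpace K] [NormedAddCommGroup E]
  [NormedSpace ℝ E] [NormedAddCommGroup F] [NormedSpace ℝ F]

/-- A continuous family of continuous linear maps, acting pointwise on continuous functions. -/
noncomputable def pointwiseCLM : C(K, E →L[ℝ] F) →L[ℝ] C(K, E) →L[ℝ] C(K, F) :=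
  LinearMap.mkContinuous₂
    (LinearMap.mk₂ ℝ (fun (A : C(K, E →L[ℝ] F)) (u : C(K, E)) =>
        (⟨fun x => A x (u x), by fun_prop⟩ : C(K, F)))
      (fun _ _ _ => by ext; simp) (fun _ _ _ => by ext; simp)
      (fun _ _ _ => by ext; simp) (fun _ _ _ => by ext; simp)) 1
    (fun A u => by
      refine (ContinuousMap.norm_le _ (by positivity)).2 fun x => ?_
      rw [one_mul]
      exact (A x).le_of_opNorm_le_of_le (A.norm_coe_le_norm x) (u.norm_coe_le_norm x))

lemma hasFDerivAt_postcomp (V : C(E, F)) (DV : C(E, E →L[ℝ] F))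
    (hV : ∀ x, HasFDerivAt V (DV x) x) (y : C(K, E)) :
    HasFDerivAt (fun u : C(K, E) => V.comp u) (pointwiseCLM (DV.comp y)) y := by
  rw [hasFDerivAt_iff_isLittleO, Asymptotics.isLittleO_iff]
  intro c hc
  obtain ⟨δ, hδ, h⟩ := (Metric.continuousAt_iff (α := C(K, E)) (β := C(K, E →L[ℝ] F))).1
    ((ContinuousMap.continuous_postcomp (X := K) DV).continuousAt (x := y)) c hc
  filter_upwards [Metric.ball_mem_nhds y hδ] with u hu
  refine (ContinuousMap.norm_le _ (by positivity)).2 fun x => ?_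
  have hux : u x ∈ Metric.ball (y x) δ :=
    lt_of_le_of_lt (ContinuousMap.dist_apply_le_dist x) hu
  have key := Convex.norm_image_sub_le_of_norm_fderiv_le' (𝕜 := ℝ) (f := V) (C := c)
    (s := Metric.ball (y x) δ) (x := y x) (y := u x) (φ := DV (y x))
    (fun z _ => (hV z).differentiableAt) (fun z hz => ?_) (convex_ball _ _)
    (Metric.mem_ball_self hδ) hux
  · calc _ ≤ c * ‖u x - y x‖ := key
      _ ≤ c * ‖u - y‖ := by
        gcongr
        exact (u - y).norm_coe_le_norm x
  · rw [(hV z).fderiv]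
    have hshift : dist (y + ContinuousMap.const K (z - y x)) y < δ := by
      rw [dist_eq_norm, add_sub_cancel_left]
      refine lt_of_le_of_lt ((ContinuousMap.norm_le _ (norm_nonneg (z - y x))).2 ?_)
        (mem_ball_iff_norm.1 hz)
      intro x'
      simp
    have := (ContinuousMap.dist_apply_le_dist x).trans_lt (h hshift)
    simpa [dist_eq_norm] using this.le

end Superposition

lemma contDiff_postcomp_nat {K E : Type} [TopologicalSpace K] [CompactSpace K]
    [NormedAddCommGroup E] [NormedSpace ℝ E] (n : ℕ) :
    ∀ {F : Type} [NormedAddCommGroup F] [NormedSpace ℝ F] (V : C(E, F)),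
      ContDiff ℝ (⊤ : ℕ∞) V → ContDiff ℝ n (fun u : C(K, E) => V.comp u) := by
  induction n with
  | zero =>
    intro F _ _ V _
    exact contDiff_zero.2 (ContinuousMap.continuous_postcomp V)
  | succ n ih =>
    intro F _ _ V hV
    have hD : ContDiff ℝ (⊤ : ℕ∞) (fderiv ℝ V) := hV.fderiv_right (by simp)
    push_cast
    rw [contDiff_succ_iff_hasFDerivAt]
    let DV : C(E, E →L[ℝ] F) := ⟨fderiv ℝ V, hD.continuous⟩
    have hp : ContDiff ℝ n (fun A : C(K, E →L[ℝ] F) => pointwiseCLM A) := by fun_prop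
    exact ⟨fun u => pointwiseCLM (DV.comp u), hp.comp (ih DV hD),
      fun u => hasFDerivAt_postcomp V DV
        (fun x => (hV.differentiable (by simp) x).hasFDerivAt) u⟩

/-- Post-composition with a smooth map is a smooth operation on continuous functions. -/
lemma contDiff_postcomp {K E F : Type} [TopologicalSpace K] [CompactSpace K]
    [NormedAddCommGroup E] [NormedSpace ℝ E] [NormedAddCommGroup F] [NormedSpace ℝ F]
    (V : C(E, F)) (hV : ContDiff ℝ (⊤ : ℕ∞) V) :
    ContDiff ℝ (⊤ : ℕ∞) (fun u : C(K, E) => V.comp u) :=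
  contDiff_infty.2 fun n => contDiff_postcomp_nat n V hV

section Volterra

variable {E : Type} [NormedAddCommGroup E] {T : ℝ}

lemma integral_norm_IccExtend_le (hT : 0 ≤ T) (u : C(Set.Icc 0 T, E)) (t : Set.Icc 0 T) :
    ∫ s in (0 : ℝ)..t, ‖Set.IccExtend hT u s‖ ≤ T * ‖u‖ := by
  calc _ ≤ ∫ s in (0 : ℝ)..t, ‖u‖ := by
        refine intervalIntegral.integral_mono_on t.2.1
          ((u.continuous.Icc_extend' (h := hT)).norm.intervalIntegrable _ _) (by simp) ?_
        intro s _
        exact u.norm_coe_le_norm _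
    _ = t * ‖u‖ := by simp
    _ ≤ T * ‖u‖ := by
        gcongr
        exact t.2.2

/-- Iterated integral inequalities yield factorial decay. -/
lemma norm_le_pow_div_factorial (hT : 0 ≤ T) {C : ℝ} (hC : 0 ≤ C)
    (f : ℕ → C(Set.Icc 0 T, E))
    (hf : ∀ n t, ‖f (n + 1) t‖ ≤ C * ∫ s in (0 : ℝ)..t, ‖Set.IccExtend hT (f n) s‖)
    (n : ℕ) (t : Set.Icc 0 T) :
    ‖f n t‖ ≤ (C * t) ^ n / n.factorial * ‖f 0‖ := by
  induction n generalizing t with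
  | zero => simpa using (f 0).norm_coe_le_norm t
  | succ n ih =>
    have hint : ∫ s in (0 : ℝ)..t, (C * s) ^ n / n.factorial * ‖f 0‖ =
        C ^ n * (t : ℝ) ^ (n + 1) / ((n + 1) * n.factorial) * ‖f 0‖ := by
      simp_rw [mul_pow, div_eq_mul_inv]
      rw [intervalIntegral.integral_mul_const, intervalIntegral.integral_mul_const,
        intervalIntegral.integral_const_mul, integral_pow, zero_pow n.succ_ne_zero, sub_zero]
      rw [mul_inv]
      ring
    calc _ ≤ C * ∫ s in (0 : ℝ)..t, ‖Set.IccExtend hT (f n) s‖ := hf n t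
      _ ≤ C * ∫ s in (0 : ℝ)..t, (C * s) ^ n / n.factorial * ‖f 0‖ := by
        gcongr
        refine intervalIntegral.integral_mono_on t.2.1
          (((f n).continuous.Icc_extend' (h := hT)).norm.intervalIntegrable _ _)
          (Continuous.intervalIntegrable (by fun_prop) _ _) fun s hs => ?_
        have hs' : s ∈ Set.Icc 0 T := ⟨hs.1, hs.2.trans t.2.2⟩
        rw [Set.IccExtend_of_mem hT _ hs']
        exact ih ⟨s, hs'⟩
      _ = _ := by
        rw [hint, Nat.factorial_succ]
        push_cast
        ring

/-- Grönwall's lemma in the form used for uniqueness. -/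
lemma eq_zero_of_volterra_bound (hT : 0 ≤ T) {C : ℝ} (hC : 0 ≤ C) (u : C(Set.Icc 0 T, E))
    (hu : ∀ t : Set.Icc 0 T, ‖u t‖ ≤ C * ∫ s in (0 : ℝ)..t, ‖Set.IccExtend hT u s‖) :
    u = 0 := by
  ext t
  have hlim := (FloorSemiring.tendsto_pow_div_factorial_atTop (C * (t : ℝ))).mul_const ‖u‖
  rw [zero_mul] at hlim
  exact norm_le_zero_iff.1 (ge_of_tendsto' hlim fun n =>
    norm_le_pow_div_factorial hT hC (fun _ => u) (fun _ s => hu s) n t)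

variable [NormedSpace ℝ E] {B : ℝ} {a : ℝ → ℝ}

lemma integrableOn_smul_IccExtend (hT : 0 ≤ T) (ha : Measurable a)
    (hb : ∀ᵐ s ∂volume.restrict (Set.Icc 0 T), ‖a s‖ ≤ B) (u : C(Set.Icc 0 T, E)) :
    IntegrableOn (fun s => a s • Set.IccExtend hT u s) (Set.Icc 0 T) := by
  have ha' : IntegrableOn a (Set.Icc 0 T) :=
    Measure.integrableOn_of_bounded (M := B) (by simp) ha.aestronglyMeasurable hb
  exact ha'.smul_continuousOn (u.continuous.Icc_extend' (h := hT)).continuousOn isCompact_Icc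

lemma intervalIntegrable_smul_IccExtend (hT : 0 ≤ T) (ha : Measurable a)
    (hb : ∀ᵐ s ∂volume.restrict (Set.Icc 0 T), ‖a s‖ ≤ B) (u : C(Set.Icc 0 T, E))
    (t : Set.Icc 0 T) :
    IntervalIntegrable (fun s => a s • Set.IccExtend hT u s) volume 0 t :=
  (intervalIntegrable_iff_integrableOn_Icc_of_le t.2.1).2
    ((integrableOn_smul_IccExtend hT ha hb u).mono_set (Set.Icc_subset_Icc_right t.2.2))

lemma norm_intervalIntegral_smul_le (hT : 0 ≤ T)
    (hb : ∀ᵐ s ∂volume.restrict (Set.Icc 0 T), ‖a s‖ ≤ B) (u : C(Set.Icc 0 T, E))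
    (t : Set.Icc 0 T) :
    ‖∫ s in (0 : ℝ)..t, a s • Set.IccExtend hT u s‖ ≤
      B * ∫ s in (0 : ℝ)..t, ‖Set.IccExtend hT u s‖ := by
  rw [← intervalIntegral.integral_const_mul]
  refine intervalIntegral.norm_integral_le_of_norm_le t.2.1 ?_ ?_
  · filter_upwards [(ae_restrict_iff' measurableSet_Icc).1 hb] with s hs hst
    rw [norm_smul]
    gcongr
    exact hs ⟨hst.1.le, hst.2.trans t.2.2⟩
  · exact ((u.continuous.Icc_extend' (h := hT)).norm.const_mul B |>.intervalIntegrable _ _)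

lemma continuous_integral_smul_IccExtend (hT : 0 ≤ T) (ha : Measurable a)
    (hb : ∀ᵐ s ∂volume.restrict (Set.Icc 0 T), ‖a s‖ ≤ B) (u : C(Set.Icc 0 T, E)) :
    Continuous fun t : Set.Icc 0 T => ∫ s in (0 : ℝ)..t, a s • Set.IccExtend hT u s := by
  have h := intervalIntegral.continuousOn_primitive_interval (a := 0) (b := T) (μ := volume)
    (by rw [Set.uIcc_of_le hT]; exact integrableOn_smul_IccExtend hT ha hb u)
  rw [Set.uIcc_of_le hT] at h
  exact continuousOn_iff_continuous_domRestrict.1 h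

/-- The Volterra operator `u ↦ ∫₀ᵗ a(s) u(s) ds` on continuous functions on `[0, T]`, for a
measurable kernel `a` that is essentially bounded on `[0, T]`. -/
noncomputable def volterra (hT : 0 ≤ T) (hB : 0 ≤ B) (ha : Measurable a)
    (hb : ∀ᵐ s ∂volume.restrict (Set.Icc 0 T), ‖a s‖ ≤ B) :
    C(Set.Icc 0 T, E) →L[ℝ] C(Set.Icc 0 T, E) :=
  LinearMap.mkContinuous
    { toFun := fun u => ⟨_, continuous_integral_smul_IccExtend hT ha hb u⟩
      map_add' := fun u v => by
        ext t
        have hi := fun w => intervalIntegrable_smul_IccExtend (E := E) hT ha hb w t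
        simp only [ContinuousMap.coe_mk, ContinuousMap.add_apply]
        rw [← intervalIntegral.integral_add (hi u) (hi v)]
        simp [Set.IccExtend]
      map_smul' := fun c u => by
        ext t
        simp only [ContinuousMap.coe_mk, ContinuousMap.smul_apply, RingHom.id_apply]
        rw [← intervalIntegral.integral_smul]
        simp [Set.IccExtend, smul_comm c] }
    (B * T) (fun u => by
      refine (ContinuousMap.norm_le _ (by positivity)).2 fun t => ?_
      refine (norm_intervalIntegral_smul_le hT hb u t).trans ?_
      rw [mul_assoc]
      gcongr
      exact integral_norm_IccExtend_le hT u t)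

lemma volterra_apply (hT : 0 ≤ T) (hB : 0 ≤ B) (ha : Measurable a)
    (hb : ∀ᵐ s ∂volume.restrict (Set.Icc 0 T), ‖a s‖ ≤ B) (u : C(Set.Icc 0 T, E))
    (t : Set.Icc 0 T) :
    volterra hT hB ha hb u t = ∫ s in (0 : ℝ)..t, a s • Set.IccExtend hT u s := rfl

lemma norm_volterra_apply_le (hT : 0 ≤ T) (hB : 0 ≤ B) (ha : Measurable a)
    (hb : ∀ᵐ s ∂volume.restrict (Set.Icc 0 T), ‖a s‖ ≤ B) {C : ℝ}
    (u v : C(Set.Icc 0 T, E)) (huv : ∀ s, ‖u s‖ ≤ C * ‖v s‖) (t : Set.Icc 0 T) :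
    ‖volterra hT hB ha hb u t‖ ≤ B * C * ∫ s in (0 : ℝ)..t, ‖Set.IccExtend hT v s‖ := by
  refine (norm_intervalIntegral_smul_le hT hb u t).trans ?_
  rw [mul_assoc]
  refine mul_le_mul_of_nonneg_left ?_ hB
  rw [← intervalIntegral.integral_const_mul]
  refine intervalIntegral.integral_mono_on t.2.1
    ((u.continuous.Icc_extend' (h := hT)).norm.intervalIntegrable _ _)
    ((v.continuous.Icc_extend' (h := hT)).norm.const_mul C |>.intervalIntegrable _ _)
    fun s _ => huv _

/-- An operator of Volterra type is quasinilpotent, so the identity minus it is invertible. -/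
lemma isUnit_one_sub_of_volterra_bound [CompleteSpace E] (hT : 0 ≤ T) {C : ℝ} (hC : 0 ≤ C)
    (A : C(Set.Icc 0 T, E) →L[ℝ] C(Set.Icc 0 T, E))
    (hA : ∀ u t, ‖A u t‖ ≤ C * ∫ s in (0 : ℝ)..t, ‖Set.IccExtend hT u s‖) :
    IsUnit (1 - A) := by
  obtain ⟨n, hn⟩ := ((FloorSemiring.tendsto_pow_div_factorial_atTop (C * T)).eventually_lt_const
    one_pos).exists
  have hnorm : ‖A ^ n‖ < 1 := by
    refine lt_of_le_of_lt (ContinuousLinearMap.opNorm_le_bound _ (by positivity) fun u => ?_) hn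
    refine (ContinuousMap.norm_le _ (by positivity)).2 fun t => ?_
    refine (norm_le_pow_div_factorial hT hC (fun k => (A ^ k) u) (fun k s => ?_) n t).trans ?_
    · rw [pow_succ']
      exact hA _ s
    · have ht := t.2.1
      have ht' := t.2.2
      simp only [pow_zero, one_apply_eq_self]
      gcongr
  have h1 := isUnit_one_sub_of_norm_lt_one
    (R := C(Set.Icc 0 T, E) →L[ℝ] C(Set.Icc 0 T, E)) hnorm
  rw [← mul_neg_geom_sum A n] at h1
  exact (Commute.isUnit_mul_iff ((Commute.one_left _).sub_left
    (Commute.sum_right _ _ _ fun i _ => (Commute.refl A).pow_right i)) |>.1 h1).1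

end Volterra

/-- The chain rule for a Lipschitz path written as the integral of its a.e. derivative. -/
lemma comp_eq_add_integral_fderiv {E : Type} [NormedAddCommGroup E] [NormedSpace ℝ E]
    [CompleteSpace E] {T M : ℝ} {y G : ℝ → E} {η : E}
    (hG : IntervalIntegrable G volume 0 T) (hM : ∀ᵐ s, s ∈ Set.Icc 0 T → ‖G s‖ ≤ M)
    (hy : ∀ t ∈ Set.Icc 0 T, y t = η + ∫ s in (0 : ℝ)..t, G s)
    {φ : E → ℝ} (hφ : ContDiff ℝ 1 φ) (t : ℝ) (ht : t ∈ Set.Icc 0 T) :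
    φ (y t) = φ η + ∫ s in (0 : ℝ)..t, fderiv ℝ φ (y s) (G s) := by
  have hT : 0 ≤ T := ht.1.trans ht.2
  have hsub : ∀ s ∈ Set.Icc 0 T, ∀ t ∈ Set.Icc 0 T, IntervalIntegrable G volume s t :=
    fun s hs t ht => hG.mono_set (by
      rw [Set.uIcc_of_le hT]; exact Set.uIcc_subset_Icc hs ht)
  have hlip : LipschitzOnWith M.toNNReal y (Set.Icc 0 T) := by
    refine LipschitzOnWith.of_dist_le_mul fun s hs t ht => ?_
    have h0 : (0 : ℝ) ∈ Set.Icc 0 T := ⟨le_rfl, hT⟩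
    rw [dist_eq_norm, hy s hs, hy t ht, add_sub_add_left_eq_sub,
      intervalIntegral.integral_interval_sub_left (hsub 0 h0 s hs) (hsub 0 h0 t ht),
      Real.dist_eq]
    refine intervalIntegral.norm_integral_le_of_norm_le_const_ae ?_
    filter_upwards [hM] with x hx hxst
    exact (hx (Set.uIcc_subset_Icc ht hs (Set.uIoc_subset_uIcc hxst))).trans
      (Real.le_coe_toNNReal M)
  have hycont : ContinuousOn y (Set.Icc 0 T) := hlip.continuousOn
  have hDcont : ContinuousOn (fun s => fderiv ℝ φ (y s)) (Set.Icc 0 T) :=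
    (hφ.continuous_fderiv (by simp)).comp_continuousOn hycont
  obtain ⟨C, hC⟩ := isCompact_Icc.exists_bound_of_continuousOn hDcont
  have hGon : IntegrableOn G (Set.Icc 0 T) :=
    (intervalIntegrable_iff_integrableOn_Icc_of_le hT).1 hG
  have hint : IntervalIntegrable (fun s => fderiv ℝ φ (y s) (G s)) volume 0 T := by
    rw [intervalIntegrable_iff_integrableOn_Icc_of_le hT]
    refine Integrable.mono' (hGon.norm.const_mul C) ?_ ?_
    · exact (ContinuousLinearMap.id ℝ (E →L[ℝ] ℝ)).aestronglyMeasurable_comp₂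
        (hDcont.aestronglyMeasurable measurableSet_Icc) hGon.1
    · filter_upwards [ae_restrict_mem measurableSet_Icc] with s hs
      exact (fderiv ℝ φ (y s)).le_of_opNorm_le (hC s hs) _
  obtain ⟨L, hL⟩ := LocallyLipschitzOn.exists_lipschitzOnWith_of_compact
    (isCompact_Icc.image_of_continuousOn hycont) hφ.locallyLipschitz.locallyLipschitzOn
  have hLy : LipschitzOnWith (L * M.toNNReal) (fun t => φ (y t)) (Set.Icc 0 T) :=
    hL.comp hlip (Set.mapsTo_image _ _)
  have hac : AbsolutelyContinuousOnInterval
      (fun t => φ (y t) - ∫ s in (0 : ℝ)..t, fderiv ℝ φ (y s) (G s)) 0 T :=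
    (LipschitzOnWith.absolutelyContinuousOnInterval
      (by rw [Set.uIcc_of_le hT]; exact hLy)).sub
      (hint.absolutelyContinuousOnInterval_intervalIntegral Set.left_mem_uIcc)
  have hne : ∀ᵐ x : ℝ, x ≠ 0 ∧ x ≠ T := by
    rw [ae_iff]
    refine measure_mono_null (t := {0, T}) (fun x hx => ?_) (Set.Finite.measure_zero (by simp) _)
    by_contra hx'
    simp_all
  obtain ⟨c, hc⟩ := hac.const_of_ae_hasDerivAt_zero (by
    filter_upwards [hint.ae_hasDerivAt_integral, hG.ae_hasDerivAt_integral, hne]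
      with x h1 h2 hx0 hx
    have hx' := hx
    rw [Set.uIcc_of_le hT] at hx'
    have hmem : Set.Icc 0 T ∈ nhds x :=
      Icc_mem_nhds (lt_of_le_of_ne hx'.1 hx0.1.symm) (lt_of_le_of_ne hx'.2 hx0.2)
    have hyd : HasDerivAt y (G x) x := by
      refine ((h2 hx 0 Set.left_mem_uIcc).const_add η).congr_of_eventuallyEq ?_
      filter_upwards [hmem] with s hs using hy s hs
    have := (((hφ.differentiable (by simp) (y x)).hasFDerivAt.comp_hasDerivAt x hyd)).sub
      (h1 hx 0 Set.left_mem_uIcc)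
    rw [sub_self] at this
    exact this)
  rw [Set.uIcc_of_le hT] at hc
  have h0 := hc 0 ⟨le_rfl, hT⟩
  have h1 := hc t ht
  have hy0 : y 0 = η := by simpa using hy 0 ⟨le_rfl, hT⟩
  simp only [intervalIntegral.integral_same, sub_zero, hy0] at h0
  linarith

section ScaledEquation

variable {E : Type} [NormedAddCommGroup E] [NormedSpace ℝ E] {T B C : ℝ} {d : ℕ}
  {L : Fin d → C(Set.Icc 0 T, E) →L[ℝ] C(Set.Icc 0 T, E)}

lemma norm_smul_sum_apply_le (hT : 0 ≤ T)
    (hL : ∀ i (u v : C(Set.Icc 0 T, E)) c, (∀ s, ‖u s‖ ≤ c * ‖v s‖) → ∀ t : Set.Icc 0 T,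
      ‖L i u t‖ ≤ B * c * ∫ s in (0 : ℝ)..t, ‖Set.IccExtend hT v s‖)
    (u : Fin d → C(Set.Icc 0 T, E)) (v : C(Set.Icc 0 T, E))
    (huv : ∀ i s, ‖u i s‖ ≤ C * ‖v s‖) (r : ℝ) (t : Set.Icc 0 T) :
    ‖(r • ∑ i, L i (u i)) t‖ ≤
      |r| * (d * (B * C)) * ∫ s in (0 : ℝ)..t, ‖Set.IccExtend hT v s‖ := by
  rw [ContinuousMap.smul_apply, ContinuousMap.sum_apply, norm_smul, Real.norm_eq_abs, mul_assoc]
  gcongr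
  refine (norm_sum_le _ _).trans ((Finset.sum_le_sum fun i _ => hL i (u i) v C (huv i) t).trans ?_)
  simp [mul_assoc]

/-- The solution of a scaled integral equation of Volterra type depends smoothly on the scale. -/
lemma contDiff_of_scaled_volterra_equation [CompleteSpace E] (hT : 0 ≤ T) (hB : 0 ≤ B)
    (hC : 0 ≤ C)
    (hL : ∀ i (u v : C(Set.Icc 0 T, E)) c, (∀ s, ‖u s‖ ≤ c * ‖v s‖) → ∀ t : Set.Icc 0 T,
      ‖L i u t‖ ≤ B * c * ∫ s in (0 : ℝ)..t, ‖Set.IccExtend hT v s‖)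
    (V : Fin d → C(E, E)) (hV : ∀ i, ContDiff ℝ (⊤ : ℕ∞) (V i))
    (hVC : ∀ i x, ‖fderiv ℝ (V i) x‖ ≤ C) (y₀ : C(Set.Icc 0 T, E))
    (y : ℝ → C(Set.Icc 0 T, E)) (hy : ∀ r, y r = y₀ + r • ∑ i, L i ((V i).comp (y r))) :
    ContDiff ℝ (⊤ : ℕ∞) y := by
  let F : ℝ × C(Set.Icc 0 T, E) → C(Set.Icc 0 T, E) :=
    fun p => p.2 - y₀ - p.1 • ∑ i, L i ((V i).comp p.2)
  have hpost : ∀ i, ContDiff ℝ (⊤ : ℕ∞) (fun u : C(Set.Icc 0 T, E) => (V i).comp u) :=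
    fun i => contDiff_postcomp (V i) (hV i)
  have hF : ContDiff ℝ (⊤ : ℕ∞) F := by
    refine (contDiff_snd.sub contDiff_const).sub (contDiff_fst.smul ?_)
    exact ContDiff.sum fun i _ => (L i).contDiff.comp ((hpost i).comp contDiff_snd)
  have hF0 : ∀ r, F (r, y r) = 0 := fun r => by
    change y r - y₀ - r • ∑ i, L i ((V i).comp (y r)) = 0
    rw [sub_sub, sub_eq_zero]
    exact hy r
  have hK : ∀ r, 0 ≤ |r| * (d * (B * C)) := fun r => by positivity
  have hVlip : ∀ i a b, ‖V i a - V i b‖ ≤ C * ‖a - b‖ := fun i a b =>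
    Convex.norm_image_sub_le_of_norm_fderiv_le (𝕜 := ℝ)
      (fun x _ => (hV i).differentiable (by simp) x) (fun x _ => hVC i x) convex_univ
      (Set.mem_univ b) (Set.mem_univ a)
  have huniq : ∀ r u, F (r, u) = 0 → u = y r := fun r u hu => by
    refine sub_eq_zero.1 (eq_zero_of_volterra_bound hT (hK r) _ fun t => ?_)
    have hdiff : u - y r = r • ∑ i, L i ((V i).comp u - (V i).comp (y r)) := by
      have h1 : u = y₀ + r • ∑ i, L i ((V i).comp u) := by
        rw [← sub_eq_zero, ← sub_sub]
        exact hu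
      nth_rewrite 1 [h1, hy r]
      simp only [map_sub, Finset.sum_sub_distrib, smul_sub]
      abel
    nth_rewrite 1 [hdiff]
    exact norm_smul_sum_apply_le hT hL _ _ (fun i s => hVlip i _ _) r t
  refine contDiff_iff_contDiffAt.2 fun r => ?_
  let DV : ∀ i, C(E, E →L[ℝ] E) := fun i =>
    ⟨fderiv ℝ (V i), (hV i).continuous_fderiv (by simp)⟩
  let A : C(Set.Icc 0 T, E) →L[ℝ] C(Set.Icc 0 T, E) :=
    r • ∑ i, (L i).comp (pointwiseCLM ((DV i).comp (y r)))
  have hA : ∀ u, A u = r • ∑ i, L i (pointwiseCLM ((DV i).comp (y r)) u) := fun u => by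
    simp [A]
  have hunit : IsUnit (1 - A) := by
    refine isUnit_one_sub_of_volterra_bound hT (hK r) A fun u t => ?_
    rw [hA]
    exact norm_smul_sum_apply_le hT hL _ _
      (fun i s => ContinuousLinearMap.le_of_opNorm_le _ (hVC i _) _) r t
  have hderiv : HasFDerivAt (fun u => F (r, u)) (1 - A) (y r) := by
    have hsum : HasFDerivAt (fun u : C(Set.Icc 0 T, E) => ∑ i, L i ((V i).comp u))
        (∑ i, (L i).comp (pointwiseCLM ((DV i).comp (y r)))) (y r) :=
      HasFDerivAt.fun_sum fun i _ => (L i).hasFDerivAt.comp (y r)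
        (hasFDerivAt_postcomp (V i) (DV i)
          (fun x => ((hV i).differentiable (by simp) x).hasFDerivAt) (y r))
    exact ((hasFDerivAt_id (y r)).sub_const y₀).sub (hsum.fun_const_smul r)
  have hinr : fderiv ℝ F (r, y r) ∘L .inr ℝ ℝ C(Set.Icc 0 T, E) = 1 - A := by
    have h1 : HasFDerivAt (fun u : C(Set.Icc 0 T, E) => (r, u))
        (.inr ℝ ℝ C(Set.Icc 0 T, E)) (y r) := hasFDerivAt_prodMk_right r (y r)
    exact ((hF.differentiable (by simp) (r, y r)).hasFDerivAt.comp (y r) h1).unique hderiv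
  have hinv : (fderiv ℝ F (r, y r) ∘L .inr ℝ ℝ C(Set.Icc 0 T, E)).IsInvertible := by
    rw [hinr]
    exact ⟨ContinuousLinearEquiv.ofUnit hunit.unit, rfl⟩
  have hn : ((⊤ : ℕ∞) : WithTop ℕ∞) ≠ 0 := by simp
  refine (hF.contDiffAt.contDiffAt_implicitFunction hn hinv).congr_of_eventuallyEq ?_
  filter_upwards [hF.contDiffAt.eventually_apply_implicitFunction hn hinv] with r' hr'
  exact (huniq r' _ (hr'.trans (hF0 r))).symm

end ScaledEquation

section ScaledExpansion

variable {Z : Type} [NormedAddCommGroup Z] [NormedSpace ℝ Z]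

lemma iteratedDeriv_succ_id_smul {f : ℝ → Z} (hf : ContDiff ℝ (⊤ : ℕ∞) f) (m : ℕ) :
    iteratedDeriv (m + 1) (fun r => r • f r) =
      fun r => r • iteratedDeriv (m + 1) f r + (m + 1 : ℝ) • iteratedDeriv m f r := by
  have hd : ∀ n r, HasDerivAt (iteratedDeriv n f) (iteratedDeriv (n + 1) f r) r := fun n r => by
    rw [iteratedDeriv_succ]
    exact (hf.differentiable_iteratedDeriv n (by exact_mod_cast ENat.natCast_lt_top n) r).hasDerivAt
  induction m with
  | zero =>
    funext r
    rw [iteratedDeriv_succ, iteratedDeriv_zero]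
    have h0 := hd 0 r
    rw [iteratedDeriv_zero] at h0
    simpa using ((hasDerivAt_id' r).fun_smul h0).deriv
  | succ m ih =>
    funext r
    rw [iteratedDeriv_succ, ih]
    refine (((hasDerivAt_id r).smul (hd (m + 1) r)).add
      ((hd m r).const_smul (m + 1 : ℝ))).deriv.trans ?_
    push_cast
    simp only [id, one_smul, add_smul]
    abel

lemma iteratedDeriv_clm_apply {W : Type} [NormedAddCommGroup W] [NormedSpace ℝ W]
    (L : Z →L[ℝ] W) {f : ℝ → Z} (hf : ContDiff ℝ (⊤ : ℕ∞) f) (m : ℕ) :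
    iteratedDeriv m (fun r => L (f r)) = fun r => L (iteratedDeriv m f r) := by
  induction m with
  | zero => simp
  | succ m ih =>
    funext r
    rw [iteratedDeriv_succ, ih, iteratedDeriv_succ]
    exact (L.hasFDerivAt.comp_hasDerivAt r (hf.differentiable_iteratedDeriv m
      (by exact_mod_cast ENat.natCast_lt_top m) r).hasDerivAt).deriv

/-- Iterating a family of linear equations scaled by `r` yields the Taylor coefficients at `0` of
its solutions, as sums over words. -/
lemma iteratedDeriv_zero_of_scaled_equation {α : Type} {d : ℕ} (D : Fin d → α → α)
    (L : Fin d → Z →L[ℝ] Z) (f : α → ℝ → Z) (hf : ∀ a, ContDiff ℝ (⊤ : ℕ∞) (f a))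
    (c : α → ℝ) (z : Z) (hfix : ∀ a r, f a r = c a • z + r • ∑ i, L i (f (D i a) r))
    (m : ℕ) (a : α) :
    iteratedDeriv m (f a) 0 = (m.factorial : ℝ) • ∑ w : Fin m → Fin d,
      c ((List.ofFn w).foldr D a) • (List.ofFn w).foldl (fun u i => L i u) z := by
  induction m generalizing a with
  | zero => simp [hfix a 0]
  | succ m ih =>
    have hLf : ∀ i, ContDiff ℝ (⊤ : ℕ∞) (fun r => L i (f (D i a) r)) :=
      fun i => (L i).contDiff.comp (hf _)
    have hsum : ContDiff ℝ (⊤ : ℕ∞) (fun r => ∑ i, L i (f (D i a) r)) :=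
      ContDiff.sum fun i _ => hLf i
    rw [funext (hfix a), iteratedDeriv_const_add m.succ_pos, iteratedDeriv_succ_id_smul hsum]
    dsimp only
    rw [zero_smul, zero_add, iteratedDeriv_fun_sum fun i _ =>
      (hLf i).contDiffAt.of_le (by exact_mod_cast le_top)]
    simp only [fun i => iteratedDeriv_clm_apply (L i) (hf (D i a)) m, ih]
    rw [← (Fin.snocEquiv fun _ : Fin (m + 1) => Fin d).sum_comp, Fintype.sum_prod_type,
      Nat.factorial_succ, Nat.cast_mul, mul_smul, Nat.cast_succ]
    simp [List.ofFn_succ', -List.ofFn_succ, Finset.smul_sum, smul_smul]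

end ScaledExpansion

section Words

variable {N d : ℕ}

lemma ae_norm_apply_le_of_lipschitzOnWith {T : ℝ} {K : NNReal} {X X' : ℝ → Fin d → ℝ}
    (hX : LipschitzOnWith K X (Set.Icc 0 T))
    (hX' : ∀ᵐ s ∂(volume.restrict (Set.Icc 0 T)), HasDerivAt X (X' s) s) (i : Fin d) :
    ∀ᵐ s ∂volume.restrict (Set.Icc 0 T), ‖X' s i‖ ≤ K := by
  rw [← restrict_Ioo_eq_restrict_Icc] at hX' ⊢
  filter_upwards [hX', ae_restrict_mem measurableSet_Ioo] with s hs hmem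
  exact (norm_le_pi_norm (X' s) i).trans
    (hs.le_of_lipschitzOn (Icc_mem_nhds hmem.1 hmem.2) hX)

lemma contDiff_vfOp {V : Fin d → (Fin N → ℝ) → (Fin N → ℝ)}
    (hV : ∀ i, ContDiff ℝ (⊤ : ℕ∞) (V i)) (i : Fin d) {φ : (Fin N → ℝ) → ℝ}
    (hφ : ContDiff ℝ (⊤ : ℕ∞) φ) : ContDiff ℝ (⊤ : ℕ∞) (vfOp V i φ) :=
  (hφ.fderiv_right (by simp)).clm_apply (hV i)

/-- `vfOp V i` as an operation on smooth functions. -/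
noncomputable def smoothVfOp {V : Fin d → (Fin N → ℝ) → (Fin N → ℝ)}
    (hV : ∀ i, ContDiff ℝ (⊤ : ℕ∞) (V i)) (i : Fin d)
    (φ : {φ : (Fin N → ℝ) → ℝ // ContDiff ℝ (⊤ : ℕ∞) φ}) :
    {φ : (Fin N → ℝ) → ℝ // ContDiff ℝ (⊤ : ℕ∞) φ} :=
  ⟨vfOp V i φ, contDiff_vfOp hV i φ.2⟩

lemma coe_foldr_smoothVfOp {V : Fin d → (Fin N → ℝ) → (Fin N → ℝ)}
    (hV : ∀ i, ContDiff ℝ (⊤ : ℕ∞) (V i))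
    (φ : {φ : (Fin N → ℝ) → ℝ // ContDiff ℝ (⊤ : ℕ∞) φ}) (l : List (Fin d)) :
    (l.foldr (smoothVfOp hV) φ).1 = iterOp V l φ := by
  induction l with
  | nil => rfl
  | cons i l ih =>
    rw [iterOp, ← ih]
    rfl

lemma intervalIntegral_smul_eq_volterra {E : Type} [NormedAddCommGroup E] [NormedSpace ℝ E]
    {T B : ℝ} {a : ℝ → ℝ} (hT : 0 ≤ T) (hB : 0 ≤ B) (ha : Measurable a)
    (hb : ∀ᵐ s ∂volume.restrict (Set.Icc 0 T), ‖a s‖ ≤ B) (u : C(Set.Icc 0 T, E)) {v : ℝ → E}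
    (huv : ∀ s (hs : s ∈ Set.Icc 0 T), u ⟨s, hs⟩ = v s) (t : Set.Icc 0 T) :
    ∫ s in (0 : ℝ)..t, a s • v s = volterra hT hB ha hb u t := by
  rw [volterra_apply]
  refine intervalIntegral.integral_congr fun s hs => ?_
  rw [Set.uIcc_of_le t.2.1] at hs
  have hs' : s ∈ Set.Icc 0 T := ⟨hs.1, hs.2.trans t.2.2⟩
  rw [Set.IccExtend_of_mem hT _ hs', huv s hs']

lemma intervalIntegrable_scaled_sum {E : Type} [NormedAddCommGroup E] [NormedSpace ℝ E]
    {T B : ℝ} {X' : ℝ → Fin d → ℝ} (hT : 0 ≤ T) (ha : ∀ i, Measurable fun s => X' s i)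
    (hb : ∀ i, ∀ᵐ s ∂volume.restrict (Set.Icc 0 T), ‖X' s i‖ ≤ B)
    (u : Fin d → C(Set.Icc 0 T, E)) {v : Fin d → ℝ → E}
    (huv : ∀ i s (hs : s ∈ Set.Icc 0 T), u i ⟨s, hs⟩ = v i s) (t : Set.Icc 0 T) (i : Fin d) :
    IntervalIntegrable (fun s => X' s i • v i s) volume 0 t :=
  (intervalIntegrable_smul_IccExtend hT (ha i) (hb i) (u i) t).congr fun s hs => by
    rw [Set.uIoc_of_le t.2.1] at hs
    have hs' : s ∈ Set.Icc 0 T := ⟨hs.1.le, hs.2.trans t.2.2⟩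
    rw [Set.IccExtend_of_mem hT _ hs', huv i s hs']

lemma intervalIntegral_scaled_sum_eq {E : Type} [NormedAddCommGroup E] [NormedSpace ℝ E]
    {T B : ℝ} {X' : ℝ → Fin d → ℝ} (hT : 0 ≤ T) (hB : 0 ≤ B)
    (ha : ∀ i, Measurable fun s => X' s i)
    (hb : ∀ i, ∀ᵐ s ∂volume.restrict (Set.Icc 0 T), ‖X' s i‖ ≤ B)
    (u : Fin d → C(Set.Icc 0 T, E)) {v : Fin d → ℝ → E}
    (huv : ∀ i s (hs : s ∈ Set.Icc 0 T), u i ⟨s, hs⟩ = v i s) (r : ℝ) (t : Set.Icc 0 T) :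
    ∫ s in (0 : ℝ)..t, ∑ i, (r * X' s i) • v i s =
      (r • ∑ i, volterra hT hB (ha i) (hb i) (u i)) t := by
  simp only [ContinuousMap.smul_apply, ContinuousMap.sum_apply, mul_smul, ← Finset.smul_sum]
  rw [intervalIntegral.integral_smul, intervalIntegral.integral_finsetSum fun i _ =>
    intervalIntegrable_scaled_sum hT ha hb u huv t i]
  simp only [fun i => intervalIntegral_smul_eq_volterra hT hB (ha i) (hb i) (u i) (huv i) t]

lemma remInt_one_eq_foldr {T B : ℝ} {X' : ℝ → Fin d → ℝ} (hT : 0 ≤ T) (hB : 0 ≤ B)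
    (ha : ∀ i, Measurable fun s => X' s i)
    (hb : ∀ i, ∀ᵐ s ∂volume.restrict (Set.Icc 0 T), ‖X' s i‖ ≤ B) (l : List (Fin d))
    (t : Set.Icc 0 T) :
    remInt X' (fun _ => 1) l t =
      l.foldr (fun i u => volterra hT hB (ha i) (hb i) u) (1 : C(Set.Icc 0 T, ℝ)) t := by
  induction l generalizing t with
  | nil => rfl
  | cons i l ih =>
    exact intervalIntegral_smul_eq_volterra hT hB (ha i) (hb i) _ (fun s hs => (ih ⟨s, hs⟩).symm) t

end Words

/-- **Derivatives in the scaling parameter extract signature coefficients**: if `Y^{η,r}` solves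
the `r`-scaled CDE `Y_t = η + Σᵢ ∫₀ᵗ r V_i(Y_s) dX^i_s`, then for every smooth `g`, every
`t ∈ [0,T]` and every `m`, the map `r ↦ g(Y_t^{η,r})` is smooth and
`(1/m!) (dᵐ/drᵐ) g(Y_t^{η,r}) |_{r=0} = Σ_{w ∈ 𝒲_m} V_w g(η) ∫_{Δ^m_{[0,t]}} dX^w`. -/
theorem scaled_solution_derivative_extracts_signature
    {d N : ℕ} (T : ℝ) (hT : 0 < T) (K : NNReal)
    (X : ℝ → Fin d → ℝ) (hX : LipschitzOnWith K X (Set.Icc 0 T))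
    (X' : ℝ → Fin d → ℝ) (hX'meas : Measurable X')
    (hX' : ∀ᵐ s ∂(volume.restrict (Set.Icc 0 T)), HasDerivAt X (X' s) s)
    (V : Fin d → (Fin N → ℝ) → (Fin N → ℝ))
    (hV : ∀ i, ContDiff ℝ (⊤ : ℕ∞) (V i))
    (hVbdd : ∀ i n, 1 ≤ n → ∃ C, ∀ x, ‖iteratedFDeriv ℝ n (V i) x‖ ≤ C)
    (η : Fin N → ℝ) (Y : ℝ → ℝ → Fin N → ℝ)
    (hYcont : ∀ r, ContinuousOn (Y r) (Set.Icc 0 T))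
    (hY : ∀ r, ∀ t ∈ Set.Icc 0 T,
      Y r t = η + ∫ s in (0:ℝ)..t, ∑ i, (r * X' s i) • V i (Y r s))
    (g : (Fin N → ℝ) → ℝ) (hg : ContDiff ℝ (⊤ : ℕ∞) g)
    (t : ℝ) (ht : t ∈ Set.Icc 0 T) (m : ℕ) :
    ContDiff ℝ (⊤ : ℕ∞) (fun r => g (Y r t)) ∧
    (m.factorial : ℝ)⁻¹ * iteratedDeriv m (fun r => g (Y r t)) 0
      = ∑ w : Fin m → Fin d,
          iterOp V (List.ofFn w) g η * iterInt X' (List.ofFn w) t := by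
  have hB : (0 : ℝ) ≤ K := K.2
  have ha : ∀ i, Measurable fun s => X' s i := fun i => (measurable_pi_apply i).comp hX'meas
  have hb := ae_norm_apply_le_of_lipschitzOnWith hX hX'
  let Vc : Fin d → C(Fin N → ℝ, Fin N → ℝ) := fun i => ⟨V i, (hV i).continuous⟩
  let Yc : ℝ → C(Set.Icc 0 T, Fin N → ℝ) := fun r =>
    ⟨fun s => Y r s, continuousOn_iff_continuous_domRestrict.1 (hYcont r)⟩
  have hYc : ∀ r, Yc r = ContinuousMap.const _ η +
      r • ∑ i, volterra hT.le hB (ha i) (hb i) ((Vc i).comp (Yc r)) := fun r => by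
    ext1 s
    rw [ContinuousMap.add_apply, ContinuousMap.const_apply, ← intervalIntegral_scaled_sum_eq
      hT.le hB ha hb _ (v := fun i s => V i (Y r s)) (fun _ _ _ => rfl)]
    exact hY r s s.2
  choose C hC using fun i => hVbdd i 1 le_rfl
  have hVC : ∀ i x, ‖fderiv ℝ (Vc i) x‖ ≤ ∑ i, |C i| := fun i x => by
    rw [← norm_iteratedFDeriv_one]
    exact ((hC i x).trans (le_abs_self _)).trans
      (Finset.single_le_sum (f := fun i => |C i|) (fun _ _ => abs_nonneg _) (Finset.mem_univ i))
  have hYsmooth : ContDiff ℝ (⊤ : ℕ∞) Yc :=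
    contDiff_of_scaled_volterra_equation hT.le hB (Finset.sum_nonneg fun _ _ => abs_nonneg _)
      (fun i u v c huv t => norm_volterra_apply_le hT.le hB (ha i) (hb i) u v huv t)
      Vc hV hVC _ Yc hYc
  let f : {φ : (Fin N → ℝ) → ℝ // ContDiff ℝ (⊤ : ℕ∞) φ} → ℝ → C(Set.Icc 0 T, ℝ) :=
    fun φ r => (⟨φ, φ.2.continuous⟩ : C(Fin N → ℝ, ℝ)).comp (Yc r)
  have hf : ∀ φ, ContDiff ℝ (⊤ : ℕ∞) (f φ) := fun φ =>
    (contDiff_postcomp (⟨φ, φ.2.continuous⟩ : C(Fin N → ℝ, ℝ)) φ.2).comp hYsmooth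
  have hfix : ∀ φ r, f φ r = φ.1 η • (1 : C(Set.Icc 0 T, ℝ)) +
      r • ∑ i, volterra hT.le hB (ha i) (hb i) (f (smoothVfOp hV i φ) r) := fun φ r => by
    have hG : IntervalIntegrable (fun s => ∑ i, (r * X' s i) • V i (Y r s)) volume 0 T :=
      ((IntervalIntegrable.sum Finset.univ fun i _ => intervalIntegrable_scaled_sum hT.le ha hb
        (fun i => (Vc i).comp (Yc r)) (v := fun i s => V i (Y r s)) (fun _ _ _ => rfl)
        ⟨T, hT.le, le_rfl⟩ i).smul r).congr
          fun s _ => by simp [Finset.smul_sum, mul_smul]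
    have hM : ∀ᵐ s, s ∈ Set.Icc 0 T → ‖∑ i, (r * X' s i) • V i (Y r s)‖ ≤
        ∑ i, |r| * K * ‖(Vc i).comp (Yc r)‖ := by
      rw [← ae_restrict_iff' measurableSet_Icc]
      filter_upwards [ae_all_iff.2 hb, ae_restrict_mem measurableSet_Icc] with s hs hmem
      refine norm_sum_le_of_le _ fun i _ => ?_
      rw [norm_smul, norm_mul, Real.norm_eq_abs r]
      gcongr
      · exact hs i
      · exact ((Vc i).comp (Yc r)).norm_coe_le_norm ⟨s, hmem⟩
    ext1 s
    rw [ContinuousMap.add_apply, ContinuousMap.smul_apply, ContinuousMap.one_apply, smul_eq_mul,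
      mul_one, ← intervalIntegral_scaled_sum_eq hT.le hB ha hb _
      (v := fun i s => vfOp V i φ (Y r s)) (fun _ _ _ => rfl)]
    refine (comp_eq_add_integral_fderiv hG hM (hY r) (φ.2.of_le (by simp)) s s.2).trans ?_
    simp only [map_sum, map_smul]
    rfl
  let ev : C(Set.Icc 0 T, ℝ) →L[ℝ] ℝ := ContinuousMap.evalCLM ℝ ⟨t, ht⟩
  have hder : iteratedDeriv m (fun r => g (Y r t)) 0 = ev (iteratedDeriv m (f ⟨g, hg⟩) 0) :=
    congrFun (iteratedDeriv_clm_apply ev (hf ⟨g, hg⟩) m) 0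
  refine ⟨ev.contDiff.comp (hf ⟨g, hg⟩), ?_⟩
  rw [hder, iteratedDeriv_zero_of_scaled_equation (smoothVfOp hV) _ f hf (fun φ => φ.1 η) 1 hfix,
    map_smul, smul_eq_mul, inv_mul_cancel_left₀ (by positivity), map_sum]
  refine Finset.sum_congr rfl fun w _ => ?_
  rw [map_smul, smul_eq_mul, coe_foldr_smoothVfOp, iterInt,
    remInt_one_eq_foldr hT.le hB ha hb _ ⟨t, ht⟩, List.foldr_reverse]
  rfl
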